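/- Let n ≥ 1, 1 ≤ p ≤ 2, 0 < α ≤ n and s > (n−α)/2. Then there is a constant C > 0, depending only on n, p, α and s, such that for every finite Borel measure μ on ℝⁿ with [μ]_α < ∞ and every Schwartz function f on ℝⁿ one has (∫_{ℝⁿ} |f(x)|^p dμ(x))^{1/p} ≤ C μ(ℝⁿ)^{1/p − 1/2} [μ]_α^{1/2} ‖f‖_{H^s}. -/

import Mathlib

open MeasureTheory Real Metric
open scoped ENNReal RealInnerProductSpace

noncomputable section

abbrev E (n : ℕ) : Type := EuclideanSpace ℝ (Fin n)

/-- The Frostman constant `[μ]_α = sup_{x,r>0} μ(B(x,r))/r^α`. -/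
def frostman {d : ℕ} (μ : Measure (E d)) (α : ℝ) : ℝ≥0∞ :=
  ⨆ (x : E d) (r : ℝ) (_ : 0 < r), μ (Metric.ball x r) / ENNReal.ofReal (r ^ α)

/-- The Fourier transform `f̂(ξ) = ∫ e^{-2πi x·ξ} f(x) dx`. -/
def FT {n : ℕ} (f : E n → ℂ) (ξ : E n) : ℂ :=
  ∫ x, Complex.exp (((-2 * π * ⟪x, ξ⟫ : ℝ) : ℂ) * Complex.I) * f x

/-- The Sobolev norm `‖f‖_{H^s} = (∫ (1+|ξ|²)^s |f̂(ξ)|² dξ)^{1/2}`. -/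
def sobolevNorm {n : ℕ} (f : E n → ℂ) (s : ℝ) : ℝ :=
  (∫ ξ : E n, (1 + ‖ξ‖ ^ 2) ^ s * ‖FT f ξ‖ ^ 2) ^ (1/2 : ℝ)

theorem measure_ball_le_frostman {d : ℕ} (μ : Measure (E d)) (α : ℝ) (x : E d) {r : ℝ}
    (hr : 0 < r) : μ (ball x r) ≤ frostman μ α * ENNReal.ofReal (r ^ α) := by
  have h : μ (ball x r) / ENNReal.ofReal (r ^ α) ≤ frostman μ α :=
    le_iSup_of_le x (le_iSup_of_le r (le_iSup_of_le hr le_rfl))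
  rwa [ENNReal.div_le_iff (by simpa using Real.rpow_pos_of_pos hr α) ENNReal.ofReal_ne_top] at h

theorem lintegral_rpow_mul_exp_neg_mul_Ioi {a r : ℝ} (ha : 0 < a) (hr : 0 < r) :
    ∫⁻ t in Set.Ioi 0, ENNReal.ofReal (t ^ (a - 1) * rexp (-(r * t))) =
      ENNReal.ofReal ((1 / r) ^ a * Gamma a) := by
  rw [← Real.integral_rpow_mul_exp_neg_mul_Ioi ha hr, ofReal_integral_eq_lintegral_ofReal]
  · refine .of_integral_ne_zero ?_
    rw [Real.integral_rpow_mul_exp_neg_mul_Ioi ha hr]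
    have := Gamma_pos_of_pos ha
    positivity
  · filter_upwards [ae_restrict_mem measurableSet_Ioi] with t ht
    have : 0 < t := ht
    positivity

theorem lintegral_gaussian_le_frostman {d : ℕ} (μ : Measure (E d)) [IsFiniteMeasure μ] {α a : ℝ}
    (hα : 0 < α) (ha : 0 < a) (x : E d) :
    ∫⁻ y, ENNReal.ofReal (rexp (-a * ‖x - y‖ ^ 2)) ∂μ ≤
      frostman μ α * ENNReal.ofReal (a ^ (-(α / 2)) * Gamma (α / 2 + 1)) := by
  have hexp (u : ℝ) (hu : 0 ≤ u) : ENNReal.ofReal (rexp (-u)) =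
      ∫⁻ v in Set.Ioi 0, (Set.Ioi u).indicator (fun v => ENNReal.ofReal (rexp (-v))) v := by
    rw [← integral_exp_neg_Ioi u, ofReal_integral_eq_lintegral_ofReal
      (by simpa [IntegrableOn] using exp_neg_integrableOn_Ioi u one_pos)
      (Filter.Eventually.of_forall fun _ => (exp_pos _).le),
      setLIntegral_indicator measurableSet_Ioi, Set.inter_eq_left.2 (Set.Ioi_subset_Ioi hu)]
  calc ∫⁻ y, ENNReal.ofReal (rexp (-a * ‖x - y‖ ^ 2)) ∂μ
      = ∫⁻ y, (∫⁻ v in Set.Ioi 0, (Set.Ioi (a * ‖x - y‖ ^ 2)).indicator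
          (fun v => ENNReal.ofReal (rexp (-v))) v) ∂μ := by
        refine lintegral_congr fun y => ?_
        rw [← hexp _ (by positivity), neg_mul]
    _ = ∫⁻ v in Set.Ioi 0, ∫⁻ y, (Set.Ioi (a * ‖x - y‖ ^ 2)).indicator
          (fun v => ENNReal.ofReal (rexp (-v))) v ∂μ := by
        refine lintegral_lintegral_swap (Measurable.aemeasurable ?_)
        have hs : MeasurableSet {z : E d × ℝ | a * ‖x - z.1‖ ^ 2 < z.2} :=
          measurableSet_lt (by fun_prop) (by fun_prop)
        exact Measurable.indicator (f := fun z : E d × ℝ => ENNReal.ofReal (rexp (-z.2)))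
          (by fun_prop) hs
    _ ≤ ∫⁻ v in Set.Ioi 0, frostman μ α * ENNReal.ofReal (a ^ (-(α / 2))) *
          ENNReal.ofReal (v ^ (α / 2 + 1 - 1) * rexp (-(1 * v))) := by
        refine setLIntegral_mono' measurableSet_Ioi fun v (hv : 0 < v) => ?_
        have hball : {y | a * ‖x - y‖ ^ 2 < v} = ball x (√(v / a)) := by
          ext y
          rw [mem_ball, dist_comm, dist_eq_norm, Real.lt_sqrt (norm_nonneg _), lt_div_iff₀ ha,
            mul_comm]
          rfl
        have hpow : (√(v / a)) ^ α = a ^ (-(α / 2)) * v ^ (α / 2) := by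
          rw [Real.sqrt_eq_rpow, ← Real.rpow_mul (by positivity), Real.div_rpow hv.le ha.le,
            Real.rpow_neg ha.le, show 1 / 2 * α = α / 2 by ring]
          field_simp
        calc ∫⁻ y, (Set.Ioi (a * ‖x - y‖ ^ 2)).indicator
              (fun v => ENNReal.ofReal (rexp (-v))) v ∂μ
            = ∫⁻ y, (ball x (√(v / a))).indicator (fun _ => ENNReal.ofReal (rexp (-v))) y ∂μ := by
              rw [← hball]; rfl
          _ = ENNReal.ofReal (rexp (-v)) * μ (ball x (√(v / a))) :=
              lintegral_indicator_const measurableSet_ball _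
          _ ≤ ENNReal.ofReal (rexp (-v)) *
                (frostman μ α * ENNReal.ofReal (a ^ (-(α / 2)) * v ^ (α / 2))) := by
              gcongr
              rw [← hpow]
              exact measure_ball_le_frostman μ α x (by positivity)
          _ = _ := by
              rw [ENNReal.ofReal_mul (by positivity), ENNReal.ofReal_mul (by positivity),
                add_sub_cancel_right, one_mul]
              ring
    _ = _ := by
        rw [lintegral_const_mul _ (by fun_prop),
          lintegral_rpow_mul_exp_neg_mul_Ioi (by positivity) one_pos, mul_assoc,
          ← ENNReal.ofReal_mul (by positivity)]
        simp

theorem lintegral_gaussian_mul_le_frostman {d : ℕ} (μ : Measure (E d)) [IsFiniteMeasure μ]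
    {α a : ℝ} (hα : 0 < α) (ha : 0 < a) {g : E d → ℝ≥0∞} (hg : Measurable g) :
    ∫⁻ z, ENNReal.ofReal (rexp (-a * ‖z.1 - z.2‖ ^ 2)) * (g z.1 * g z.2) ∂(μ.prod μ) ≤
      2 * (frostman μ α * ENNReal.ofReal (a ^ (-(α / 2)) * Gamma (α / 2 + 1)) *
        ∫⁻ x, g x ^ 2 ∂μ) := by
  set M := frostman μ α * ENNReal.ofReal (a ^ (-(α / 2)) * Gamma (α / 2 + 1))
  have hmul (u v : ℝ≥0∞) : u * v ≤ u ^ 2 + v ^ 2 := by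
    rcases le_total u v with h | h
    · calc u * v ≤ v * v := by gcongr
        _ = v ^ 2 := (sq v).symm
        _ ≤ _ := le_add_self
    · calc u * v ≤ u * u := by gcongr
        _ = u ^ 2 := (sq u).symm
        _ ≤ _ := le_self_add
  have hhalf : ∫⁻ x, ∫⁻ y, ENNReal.ofReal (rexp (-a * ‖x - y‖ ^ 2)) * g x ^ 2 ∂μ ∂μ ≤
      M * ∫⁻ x, g x ^ 2 ∂μ := by
    rw [← lintegral_const_mul _ (by fun_prop)]
    refine lintegral_mono fun x => ?_
    rw [lintegral_mul_const _ (by fun_prop)]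
    gcongr
    exact lintegral_gaussian_le_frostman μ hα ha x
  calc ∫⁻ z, ENNReal.ofReal (rexp (-a * ‖z.1 - z.2‖ ^ 2)) * (g z.1 * g z.2) ∂(μ.prod μ)
      ≤ ∫⁻ z, (ENNReal.ofReal (rexp (-a * ‖z.1 - z.2‖ ^ 2)) * g z.1 ^ 2 +
          ENNReal.ofReal (rexp (-a * ‖z.1 - z.2‖ ^ 2)) * g z.2 ^ 2) ∂(μ.prod μ) := by
        refine lintegral_mono fun z => ?_
        rw [← mul_add]
        gcongr
        exact hmul _ _
    _ = ∫⁻ x, ∫⁻ y, ENNReal.ofReal (rexp (-a * ‖x - y‖ ^ 2)) * g x ^ 2 ∂μ ∂μ +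
          ∫⁻ y, ∫⁻ x, ENNReal.ofReal (rexp (-a * ‖x - y‖ ^ 2)) * g y ^ 2 ∂μ ∂μ := by
        rw [lintegral_add_left (by fun_prop), lintegral_prod _ (by fun_prop),
          lintegral_prod_symm _ (by fun_prop)]
    _ ≤ M * ∫⁻ x, g x ^ 2 ∂μ + M * ∫⁻ x, g x ^ 2 ∂μ := by
        refine add_le_add hhalf ((le_of_eq ?_).trans hhalf)
        simp_rw [norm_sub_rev]
    _ = _ := (two_mul _).symm

/-- The Fourier transform of the complex measure `f μ`. -/
def measureFT {n : ℕ} (μ : Measure (E n)) (f : E n → ℂ) (ξ : E n) : ℂ :=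
  ∫ x, Complex.exp (((-2 * π * ⟪x, ξ⟫ : ℝ) : ℂ) * Complex.I) * f x ∂μ

theorem integral_gaussian_mul_character {n : ℕ} {b : ℝ} (hb : 0 < b) (w : E n) :
    ∫ ξ : E n, ((rexp (-b * ‖ξ‖ ^ 2) : ℝ) : ℂ) *
        Complex.exp (((-2 * π * ⟪w, ξ⟫ : ℝ) : ℂ) * Complex.I) =
      (((π / b) ^ ((n : ℝ) / 2) * rexp (-(π ^ 2 / b) * ‖w‖ ^ 2) : ℝ) : ℂ) := by
  have h := GaussianFourier.integral_cexp_neg_mul_sq_norm_add (V := E n) (b := (b : ℂ))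
    (by simpa using hb) (-2 * π * Complex.I) w
  have hb' : (b : ℂ) ≠ 0 := by exact_mod_cast hb.ne'
  convert h using 1
  · congr 1 with ξ
    rw [Complex.ofReal_exp, ← Complex.exp_add]
    congr 1
    push_cast
    ring
  · rw [Complex.ofReal_mul, Complex.ofReal_exp, Complex.ofReal_cpow (by positivity)]
    congr 2
    · push_cast; rfl
    · simp
    · push_cast
      field_simp
      ring_nf
      simp

open ComplexConjugate in
theorem lintegral_gaussian_mul_measureFT_le {n : ℕ} (μ : Measure (E n)) [IsFiniteMeasure μ]
    {f : E n → ℂ} (hf : Integrable f μ) {b : ℝ} (hb : 0 < b) :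
    ∫⁻ ξ, ENNReal.ofReal (rexp (-b * ‖ξ‖ ^ 2)) * ‖measureFT μ f ξ‖ₑ ^ 2 ≤
      ENNReal.ofReal ((π / b) ^ ((n : ℝ) / 2)) *
        ∫⁻ z, ENNReal.ofReal (rexp (-(π ^ 2 / b) * ‖z.1 - z.2‖ ^ 2)) *
          (‖f z.1‖ₑ * ‖f z.2‖ₑ) ∂(μ.prod μ) := by
  let e : E n → E n → ℂ := fun x ξ => Complex.exp (((-2 * π * ⟪x, ξ⟫ : ℝ) : ℂ) * Complex.I)
  have he (x ξ : E n) : ‖e x ξ‖ = 1 := Complex.norm_exp_ofReal_mul_I _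
  have hprod (x y ξ : E n) : e x ξ * conj (e y ξ) = e (x - y) ξ := by
    simp only [e]
    rw [← Complex.exp_conj, ← Complex.exp_add, inner_sub_left]
    congr 1
    simp only [map_mul, Complex.conj_ofReal, Complex.conj_I]
    push_cast
    ring
  have hgauss : Integrable (fun ξ : E n => ((rexp (-b * ‖ξ‖ ^ 2) : ℝ) : ℂ)) := by
    have := GaussianFourier.integrable_cexp_neg_mul_sq_norm_add (V := E n) (b := (b : ℂ))
      (by simpa using hb) 0 0
    simpa using this
  have hff : Integrable (fun z : E n × E n => f z.1 * conj (f z.2)) (μ.prod μ) :=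
    hf.mul_prod ((Complex.conjCLE.toContinuousLinearMap.integrable_comp hf))
  let Φ : E n → E n × E n → ℂ := fun ξ z =>
    e (z.1 - z.2) ξ * (((rexp (-b * ‖ξ‖ ^ 2) : ℝ) : ℂ) * (f z.1 * conj (f z.2)))
  have hΦ : Integrable (Function.uncurry Φ) (volume.prod (μ.prod μ)) := by
    refine (hgauss.mul_prod hff).bdd_mul (c := 1) ?_
      (Filter.Eventually.of_forall fun z => (he _ _).le)
    refine Continuous.aestronglyMeasurable ?_
    simp only [e]
    fun_prop
  have hsq (ξ : E n) : ∫ z, Φ ξ z ∂(μ.prod μ) =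
      ((rexp (-b * ‖ξ‖ ^ 2) * ‖measureFT μ f ξ‖ ^ 2 : ℝ) : ℂ) := by
    rw [Complex.ofReal_mul, Complex.ofReal_pow, ← Complex.mul_conj', measureFT,
      ← integral_conj, ← integral_prod_mul, ← integral_const_mul]
    congr 1 with z
    simp only [Φ]
    rw [← hprod, map_mul]
    simp only [e]
    ring
  have hInt : Integrable (fun ξ => rexp (-b * ‖ξ‖ ^ 2) * ‖measureFT μ f ξ‖ ^ 2) := by
    have := hΦ.integral_prod_left
    simp only [Function.uncurry_apply_pair, hsq] at this
    exact_mod_cast this.re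
  calc ∫⁻ ξ, ENNReal.ofReal (rexp (-b * ‖ξ‖ ^ 2)) * ‖measureFT μ f ξ‖ₑ ^ 2
      = ∫⁻ ξ, ENNReal.ofReal (rexp (-b * ‖ξ‖ ^ 2) * ‖measureFT μ f ξ‖ ^ 2) := by
        refine lintegral_congr fun ξ => ?_
        rw [ENNReal.ofReal_mul (exp_pos _).le, ENNReal.ofReal_pow (norm_nonneg _), ofReal_norm]
    _ = ENNReal.ofReal (∫ ξ, rexp (-b * ‖ξ‖ ^ 2) * ‖measureFT μ f ξ‖ ^ 2) :=
        (ofReal_integral_eq_lintegral_ofReal hInt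
          (Filter.Eventually.of_forall fun ξ => by positivity)).symm
    _ = ‖∫ ξ, ∫ z, Φ ξ z ∂(μ.prod μ)‖ₑ := by
        simp only [hsq]
        rw [integral_complex_ofReal, ← ofReal_norm, Complex.norm_real, Real.norm_of_nonneg]
        exact integral_nonneg fun ξ => by positivity
    _ = ‖∫ z, (∫ ξ, Φ ξ z) ∂(μ.prod μ)‖ₑ := by rw [integral_integral_swap hΦ]
    _ ≤ ∫⁻ z, ‖∫ ξ, Φ ξ z‖ₑ ∂(μ.prod μ) := enorm_integral_le_lintegral_enorm _
    _ = ∫⁻ z, ENNReal.ofReal ((π / b) ^ ((n : ℝ) / 2)) *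
          (ENNReal.ofReal (rexp (-(π ^ 2 / b) * ‖z.1 - z.2‖ ^ 2)) *
          (‖f z.1‖ₑ * ‖f z.2‖ₑ)) ∂(μ.prod μ) := by
        refine lintegral_congr fun z => ?_
        have : ∫ ξ, Φ ξ z = (((π / b) ^ ((n : ℝ) / 2) *
            rexp (-(π ^ 2 / b) * ‖z.1 - z.2‖ ^ 2) : ℝ) : ℂ) * (f z.1 * conj (f z.2)) := by
          rw [← integral_gaussian_mul_character hb, ← integral_mul_const]
          congr 1 with ξ
          simp only [Φ, e]
          ring
        rw [this, enorm_mul, enorm_mul, RCLike.enorm_conj, ← ofReal_norm, Complex.norm_real,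
          Real.norm_of_nonneg (by positivity), ENNReal.ofReal_mul (by positivity), mul_assoc]
    _ = _ := lintegral_const_mul' _ _ ENNReal.ofReal_ne_top

theorem measurable_measureFT {n : ℕ} (μ : Measure (E n)) [IsFiniteMeasure μ] {f : E n → ℂ}
    (hf : Measurable f) : Measurable (measureFT μ f) := by
  refine (StronglyMeasurable.integral_prod_right (f := fun ξ x =>
    Complex.exp (((-2 * π * ⟪x, ξ⟫ : ℝ) : ℂ) * Complex.I) * f x) ?_).measurable
  exact Measurable.stronglyMeasurable (by fun_prop)

theorem exists_lintegral_measureFT_le {n : ℕ} {α s : ℝ} (hα₀ : 0 < α) (hα₁ : α ≤ n)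
    (hs : ((n : ℝ) - α) / 2 < s) :
    ∃ K : ℝ, 0 < K ∧ ∀ (μ : Measure (E n)), IsFiniteMeasure μ → ∀ f : E n → ℂ, Measurable f →
      Integrable f μ →
        ∫⁻ ξ, ENNReal.ofReal ((1 + ‖ξ‖ ^ 2) ^ (-s)) * ‖measureFT μ f ξ‖ₑ ^ 2 ≤
          ENNReal.ofReal K * frostman μ α * ∫⁻ x, ‖f x‖ₑ ^ 2 ∂μ := by
  have hs₀ : 0 < s := by linarith
  set γ := s - ((n : ℝ) - α) / 2 with hγ
  have hγ₀ : 0 < γ := by linarith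
  have hΓs := Gamma_pos_of_pos hs₀
  have hΓα := Gamma_pos_of_pos (show 0 < α / 2 + 1 by positivity)
  have hΓγ := Gamma_pos_of_pos hγ₀
  refine ⟨(Gamma s)⁻¹ * (2 * π ^ ((n : ℝ) / 2 - α) * Gamma (α / 2 + 1) * Gamma γ),
    by positivity, fun μ _ f hf hfi => ?_⟩
  set A := ∫⁻ x, ‖f x‖ₑ ^ 2 ∂μ
  set F := frostman μ α
  have hH := measurable_measureFT μ hf
  have hsub (ξ : E n) : ENNReal.ofReal ((1 + ‖ξ‖ ^ 2) ^ (-s)) = ENNReal.ofReal (Gamma s)⁻¹ *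
      ∫⁻ t in Set.Ioi 0, ENNReal.ofReal (t ^ (s - 1) * rexp (-((1 + ‖ξ‖ ^ 2) * t))) := by
    rw [lintegral_rpow_mul_exp_neg_mul_Ioi hs₀ (by positivity),
      ← ENNReal.ofReal_mul (by positivity), one_div, Real.inv_rpow (by positivity),
      Real.rpow_neg (by positivity)]
    congr 1
    field_simp
  calc ∫⁻ ξ, ENNReal.ofReal ((1 + ‖ξ‖ ^ 2) ^ (-s)) * ‖measureFT μ f ξ‖ₑ ^ 2
      = ENNReal.ofReal (Gamma s)⁻¹ * ∫⁻ ξ, ∫⁻ t in Set.Ioi 0,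
          ENNReal.ofReal (t ^ (s - 1) * rexp (-((1 + ‖ξ‖ ^ 2) * t))) *
            ‖measureFT μ f ξ‖ₑ ^ 2 := by
        rw [← lintegral_const_mul _ (by fun_prop)]
        refine lintegral_congr fun ξ => ?_
        rw [lintegral_mul_const _ (by fun_prop), hsub, mul_assoc]
    _ = ENNReal.ofReal (Gamma s)⁻¹ * ∫⁻ t in Set.Ioi 0, ∫⁻ ξ,
          ENNReal.ofReal (t ^ (s - 1) * rexp (-((1 + ‖ξ‖ ^ 2) * t))) *
            ‖measureFT μ f ξ‖ₑ ^ 2 := by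
        rw [lintegral_lintegral_swap (by fun_prop)]
    _ ≤ ENNReal.ofReal (Gamma s)⁻¹ * ∫⁻ t in Set.Ioi 0,
          (ENNReal.ofReal (2 * π ^ ((n : ℝ) / 2 - α) * Gamma (α / 2 + 1)) * F * A) *
            ENNReal.ofReal (t ^ (γ - 1) * rexp (-(1 * t))) := by
        gcongr ENNReal.ofReal (Gamma s)⁻¹ * ?_
        refine setLIntegral_mono' measurableSet_Ioi fun t (ht : 0 < t) => ?_
        have hreal : t ^ (s - 1) * rexp (-t) * (π / t) ^ ((n : ℝ) / 2) * 2 *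
            ((π ^ 2 / t) ^ (-(α / 2)) * Gamma (α / 2 + 1)) =
            2 * π ^ ((n : ℝ) / 2 - α) * Gamma (α / 2 + 1) * (t ^ (γ - 1) * rexp (-(1 * t))) := by
          have h₁ : (π ^ 2 / t) ^ (-(α / 2)) = π ^ (-α) * t ^ (α / 2) := by
            rw [Real.div_rpow (by positivity) ht.le, ← Real.rpow_natCast, ← Real.rpow_mul pi_nonneg,
              Real.rpow_neg ht.le, div_inv_eq_mul]
            congr 2
            push_cast
            ring
          have h₂ : t ^ (γ - 1) = t ^ (s - 1) * (t ^ ((n : ℝ) / 2))⁻¹ * t ^ (α / 2) := by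
            rw [← Real.rpow_neg ht.le, ← Real.rpow_add ht, ← Real.rpow_add ht]
            congr 1
            rw [hγ]
            ring
          rw [h₁, h₂, Real.div_rpow pi_nonneg ht.le, sub_eq_add_neg (_ / _),
            Real.rpow_add pi_pos, one_mul]
          ring
        calc ∫⁻ ξ, ENNReal.ofReal (t ^ (s - 1) * rexp (-((1 + ‖ξ‖ ^ 2) * t))) *
              ‖measureFT μ f ξ‖ₑ ^ 2
            = ENNReal.ofReal (t ^ (s - 1) * rexp (-t)) *
                ∫⁻ ξ, ENNReal.ofReal (rexp (-t * ‖ξ‖ ^ 2)) * ‖measureFT μ f ξ‖ₑ ^ 2 := by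
              rw [← lintegral_const_mul _ (by fun_prop)]
              refine lintegral_congr fun ξ => ?_
              rw [← mul_assoc, ← ENNReal.ofReal_mul (by positivity), mul_assoc (t ^ (s - 1)),
                ← Real.exp_add]
              ring_nf
          _ ≤ ENNReal.ofReal (t ^ (s - 1) * rexp (-t)) *
                (ENNReal.ofReal ((π / t) ^ ((n : ℝ) / 2)) * (2 * (F *
                  ENNReal.ofReal ((π ^ 2 / t) ^ (-(α / 2)) * Gamma (α / 2 + 1)) * A))) := by
              gcongr
              refine (lintegral_gaussian_mul_measureFT_le μ hfi ht).trans ?_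
              gcongr
              exact lintegral_gaussian_mul_le_frostman μ hα₀ (by positivity) (by fun_prop)
          _ = ENNReal.ofReal (t ^ (s - 1) * rexp (-t) * (π / t) ^ ((n : ℝ) / 2) * 2 *
                ((π ^ 2 / t) ^ (-(α / 2)) * Gamma (α / 2 + 1))) * F * A := by
              rw [ENNReal.ofReal_mul (q := _ * Gamma _) (by positivity),
                ENNReal.ofReal_mul (q := 2) (by positivity),
                ENNReal.ofReal_mul (q := (π / t) ^ _) (by positivity), ENNReal.ofReal_ofNat]
              ring
          _ = _ := by
              rw [hreal, ENNReal.ofReal_mul (by positivity)]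
              ring
    _ = _ := by
        rw [lintegral_const_mul _ (by fun_prop), lintegral_rpow_mul_exp_neg_mul_Ioi hγ₀ one_pos,
          div_one, Real.one_rpow, one_mul, ENNReal.ofReal_mul (p := (Gamma s)⁻¹) (by positivity),
          ENNReal.ofReal_mul (q := Gamma γ) (by positivity)]
        ring

theorem FT_eq_fourier {n : ℕ} (f : SchwartzMap (E n) ℂ) (ξ : E n) :
    FT f ξ = FourierTransform.fourier f ξ := by
  rw [SchwartzMap.fourier_coe, Real.fourier_eq']
  rfl

theorem integrable_sobolev_integrand {n : ℕ} (f : SchwartzMap (E n) ℂ) (s : ℝ) :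
    Integrable fun ξ : E n => (1 + ‖ξ‖ ^ 2) ^ s * ‖FT f ξ‖ ^ 2 := by
  have hg := Function.hasTemperateGrowth_one_add_norm_sq_rpow (E n) (s / 2)
  have h := ((SchwartzMap.smulLeftCLM ℂ (fun ξ : E n => (1 + ‖ξ‖ ^ 2) ^ (s / 2))
    (FourierTransform.fourier f)).memLp 2).integrable_norm_pow two_ne_zero
  refine h.congr (Filter.Eventually.of_forall fun ξ => ?_)
  have hpos : (0 : ℝ) ≤ 1 + ‖ξ‖ ^ 2 := by positivity
  simp only [SchwartzMap.smulLeftCLM_apply_apply hg, norm_smul, mul_pow, FT_eq_fourier]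
  rw [Real.norm_of_nonneg (by positivity), ← Real.rpow_natCast, ← Real.rpow_mul hpos]
  norm_num

open ComplexConjugate in
theorem integral_norm_sq_eq_integral_FT_mul {n : ℕ} (μ : Measure (E n)) [IsFiniteMeasure μ]
    (f : SchwartzMap (E n) ℂ) :
    ((∫ x, ‖f x‖ ^ 2 ∂μ : ℝ) : ℂ) = ∫ ξ, FT f ξ * conj (measureFT μ f ξ) := by
  have hinv (x : E n) :
      f x = ∫ ξ, Complex.exp (((2 * π * ⟪ξ, x⟫ : ℝ) : ℂ) * Complex.I) * FT f ξ := by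
    have h : f x = FourierTransform.fourierInv (FourierTransform.fourier f) x := by
      rw [FourierTransform.fourierInv_fourier_eq f]
    rw [h, SchwartzMap.fourierInv_coe, Real.fourierInv_eq']
    simp only [FT_eq_fourier, smul_eq_mul]
  have hInt : Integrable (Function.uncurry fun (x ξ : E n) =>
      Complex.exp (((2 * π * ⟪ξ, x⟫ : ℝ) : ℂ) * Complex.I) * (conj (f x) * FT f ξ))
      (μ.prod volume) := by
    refine Integrable.bdd_mul (c := 1) (Integrable.mul_prod (f := fun x => conj (f x)) ?_ ?_) ?_
      (Filter.Eventually.of_forall fun z => (Complex.norm_exp_ofReal_mul_I _).le)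
    · exact Complex.conjCLE.toContinuousLinearMap.integrable_comp (memLp_one_iff_integrable.1 (f.memLp 1 μ))
    · exact (FourierTransform.fourier f).integrable.congr
        (Filter.Eventually.of_forall fun ξ => (FT_eq_fourier f ξ).symm)
    · exact Continuous.aestronglyMeasurable (by fun_prop)
  rw [← integral_complex_ofReal]
  calc ∫ x, ((‖f x‖ ^ 2 : ℝ) : ℂ) ∂μ
      = ∫ x, (∫ ξ, Complex.exp (((2 * π * ⟪ξ, x⟫ : ℝ) : ℂ) * Complex.I) *
          (conj (f x) * FT f ξ)) ∂μ := by
        congr 1 with x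
        rw [Complex.ofReal_pow, ← Complex.conj_mul']
        refine (congrArg (conj (f x) * ·) (hinv x)).trans ?_
        simp only [← integral_const_mul]
        congr 1 with ξ
        ring
    _ = ∫ ξ, (∫ x, Complex.exp (((2 * π * ⟪ξ, x⟫ : ℝ) : ℂ) * Complex.I) *
          (conj (f x) * FT f ξ) ∂μ) := integral_integral_swap hInt
    _ = _ := by
        congr 1 with ξ
        rw [measureFT, ← integral_conj, ← integral_const_mul]
        congr 1 with x
        rw [map_mul, ← Complex.exp_conj, map_mul, Complex.conj_ofReal, Complex.conj_I,
          real_inner_comm]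
        push_cast
        ring_nf

theorem lintegral_enorm_sq_le_of_measureFT_le {n : ℕ} (μ : Measure (E n)) [IsFiniteMeasure μ]
    (f : SchwartzMap (E n) ℂ) {s : ℝ} {M : ℝ≥0∞}
    (hM : ∫⁻ ξ, ENNReal.ofReal ((1 + ‖ξ‖ ^ 2) ^ (-s)) * ‖measureFT μ f ξ‖ₑ ^ 2 ≤
      M * ∫⁻ x, ‖f x‖ₑ ^ 2 ∂μ) :
    ∫⁻ x, ‖f x‖ₑ ^ 2 ∂μ ≤
      M * ENNReal.ofReal (∫ ξ : E n, (1 + ‖ξ‖ ^ 2) ^ s * ‖FT f ξ‖ ^ 2) := by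
  set A := ∫⁻ x, ‖f x‖ₑ ^ 2 ∂μ with hA
  set S := ENNReal.ofReal (∫ ξ : E n, (1 + ‖ξ‖ ^ 2) ^ s * ‖FT f ξ‖ ^ 2) with hS
  have hpos (ξ : E n) : 0 < 1 + ‖ξ‖ ^ 2 := by positivity
  have hfi : Integrable (fun x => ‖f x‖ ^ 2) μ := (f.memLp 2 μ).integrable_norm_pow two_ne_zero
  have hA' : A = ENNReal.ofReal (∫ x, ‖f x‖ ^ 2 ∂μ) := by
    rw [ofReal_integral_eq_lintegral_ofReal hfi
      (Filter.Eventually.of_forall fun x => by positivity)]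
    simp only [ENNReal.ofReal_pow (norm_nonneg _), ofReal_norm, hA]
  have hFTm : Measurable (FT f) := by
    rw [funext (FT_eq_fourier f)]
    exact (FourierTransform.fourier f).continuous.measurable
  have hHm := measurable_measureFT μ f.continuous.measurable
  have hsq (r : ℝ) (ξ : E n) (z : ℂ) :
      (ENNReal.ofReal ((1 + ‖ξ‖ ^ 2) ^ (r / 2)) * ‖z‖ₑ) ^ (2 : ℝ) =
        ENNReal.ofReal ((1 + ‖ξ‖ ^ 2) ^ r) * ‖z‖ₑ ^ 2 := by
    rw [ENNReal.rpow_two, mul_pow, ← ENNReal.ofReal_pow (by positivity), ← Real.rpow_natCast,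
      ← Real.rpow_mul (hpos ξ).le]
    norm_num
  have hS' : S = ∫⁻ ξ : E n, ENNReal.ofReal ((1 + ‖ξ‖ ^ 2) ^ s) * ‖FT f ξ‖ₑ ^ 2 := by
    rw [hS, ofReal_integral_eq_lintegral_ofReal (integrable_sobolev_integrand f s)
      (Filter.Eventually.of_forall fun ξ => by positivity)]
    refine lintegral_congr fun ξ => ?_
    rw [ENNReal.ofReal_mul (by positivity), ENNReal.ofReal_pow (norm_nonneg _), ofReal_norm]
  have hle : A ≤ S ^ (1 / 2 : ℝ) * (M * A) ^ (1 / 2 : ℝ) := by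
    calc A = ‖((∫ x, ‖f x‖ ^ 2 ∂μ : ℝ) : ℂ)‖ₑ := by
          rw [hA', ← ofReal_norm, Complex.norm_real, Real.norm_of_nonneg]
          exact integral_nonneg fun x => by positivity
      _ ≤ ∫⁻ ξ, ‖FT f ξ * starRingEnd ℂ (measureFT μ f ξ)‖ₑ := by
          rw [integral_norm_sq_eq_integral_FT_mul]
          exact enorm_integral_le_lintegral_enorm _
      _ = ∫⁻ ξ, ((fun ξ => ENNReal.ofReal ((1 + ‖ξ‖ ^ 2) ^ (s / 2)) * ‖FT f ξ‖ₑ) *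
            fun ξ => ENNReal.ofReal ((1 + ‖ξ‖ ^ 2) ^ (-s / 2)) * ‖measureFT μ f ξ‖ₑ) ξ := by
          refine lintegral_congr fun ξ => ?_
          rw [Pi.mul_apply, mul_mul_mul_comm, ← ENNReal.ofReal_mul (by positivity),
            ← Real.rpow_add (hpos ξ), enorm_mul, RCLike.enorm_conj]
          simp [neg_div]
      _ ≤ _ := by
          refine (ENNReal.lintegral_mul_le_Lp_mul_Lq volume Real.HolderConjugate.two_two
            (by fun_prop) (by fun_prop)).trans ?_
          simp only [hsq]
          rw [hS']
          gcongr
  rcases eq_or_ne A 0 with h₀ | h₀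
  · simp [h₀]
  have hle' : A * A ≤ M * S * A := by
    calc A * A ≤ (S ^ (1 / 2 : ℝ) * (M * A) ^ (1 / 2 : ℝ)) *
          (S ^ (1 / 2 : ℝ) * (M * A) ^ (1 / 2 : ℝ)) := by gcongr
      _ = (S * (M * A)) ^ (1 / 2 + 1 / 2 : ℝ) := by
          rw [← ENNReal.mul_rpow_of_nonneg _ _ (by norm_num),
            ENNReal.rpow_add_of_nonneg _ _ (by norm_num) (by norm_num)]
      _ = M * S * A := by
          rw [add_halves, ENNReal.rpow_one]
          ring
  exact (ENNReal.mul_le_mul_iff_left h₀ (hA' ▸ ENNReal.ofReal_ne_top)).1 hle'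

/-- a generalised trace theorem, `‖f‖_{L^p(dμ)} ≲ μ(ℝⁿ)^{1/p-1/2} [μ]_α^{1/2}
‖f‖_{H^s}` for `s > (n-α)/2`. -/
theorem generalised_trace (n : ℕ) (hn : 1 ≤ n) (p α s : ℝ)
    (hp₁ : 1 ≤ p) (hp₂ : p ≤ 2) (hα₀ : 0 < α) (hα₁ : α ≤ n) (hs : ((n : ℝ) - α) / 2 < s) :
    ∃ C : ℝ, 0 < C ∧
      ∀ (μ : Measure (E n)), IsFiniteMeasure μ → frostman μ α < ⊤ →
        ∀ (f : SchwartzMap (E n) ℂ),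
          (∫ x, ‖f x‖ ^ p ∂μ) ^ (1/p) ≤
            C * (μ Set.univ).toReal ^ (1/p - 1/2) * (frostman μ α).toReal ^ (1/2 : ℝ) *
              sobolevNorm (⇑f) s := by
  obtain ⟨K, hK, hKle⟩ := exists_lintegral_measureFT_le hα₀ hα₁ hs
  refine ⟨K ^ (1 / 2 : ℝ), by positivity, fun μ _ hF f => ?_⟩
  have hp₀ : 0 < p := by linarith
  have hpt : (ENNReal.ofReal p).toReal = p := ENNReal.toReal_ofReal hp₀.le
  set I := ∫ ξ : E n, (1 + ‖ξ‖ ^ 2) ^ s * ‖FT f ξ‖ ^ 2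
  have hI : 0 ≤ I := integral_nonneg fun ξ => by positivity
  have htrace := lintegral_enorm_sq_le_of_measureFT_le μ f
    (hKle μ inferInstance f f.continuous.measurable (memLp_one_iff_integrable.1 (f.memLp 1 μ)))
  have hL2 : eLpNorm f 2 μ ≤ (ENNReal.ofReal K * frostman μ α * ENNReal.ofReal I) ^ (1 / 2 : ℝ) := by
    rw [eLpNorm_eq_lintegral_rpow_enorm_toReal two_ne_zero ENNReal.ofNat_ne_top]
    simp only [ENNReal.toReal_ofNat, ENNReal.rpow_two]
    gcongr
  have hLp : eLpNorm f (ENNReal.ofReal p) μ ≤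
      (ENNReal.ofReal K * frostman μ α * ENNReal.ofReal I) ^ (1 / 2 : ℝ) *
        μ Set.univ ^ (1 / p - 1 / 2) := by
    refine (eLpNorm_le_eLpNorm_mul_rpow_measure_univ (q := 2) ?_
      f.continuous.aestronglyMeasurable).trans ?_
    · exact ENNReal.ofReal_le_of_le_toReal (by simpa using hp₂)
    · rw [hpt, ENNReal.toReal_ofNat]
      gcongr
  have hexp : 0 ≤ 1 / p - 1 / 2 := sub_nonneg.2 (one_div_le_one_div_of_le hp₀ hp₂)
  have hfin : (ENNReal.ofReal K * frostman μ α * ENNReal.ofReal I) ^ (1 / 2 : ℝ) *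
        μ Set.univ ^ (1 / p - 1 / 2) ≠ ⊤ := by
    refine ENNReal.mul_ne_top (ENNReal.rpow_ne_top_of_nonneg (by norm_num) ?_)
      (ENNReal.rpow_ne_top_of_nonneg hexp (measure_ne_top _ _))
    exact ENNReal.mul_ne_top (ENNReal.mul_ne_top ENNReal.ofReal_ne_top hF.ne) ENNReal.ofReal_ne_top
  have hreal := ENNReal.toReal_mono hfin hLp
  rw [(f.memLp (ENNReal.ofReal p) μ).eLpNorm_eq_integral_rpow_norm (by simpa using hp₀)
    ENNReal.ofReal_ne_top, hpt, ENNReal.toReal_ofReal (by positivity), ENNReal.toReal_mul,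
    ← ENNReal.toReal_rpow, ← ENNReal.toReal_rpow, ENNReal.toReal_mul, ENNReal.toReal_mul,
    ENNReal.toReal_ofReal hK.le, ENNReal.toReal_ofReal hI,
    Real.mul_rpow (by positivity) hI, Real.mul_rpow hK.le ENNReal.toReal_nonneg, ← one_div] at hreal
  refine hreal.trans (le_of_eq ?_)
  simp only [sobolevNorm]
  ring
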